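/- Fix κ > 0, r > 0, m ≥ 2, μ > 0 and c ∈ ℝ. For ε ∈ (0,1) let δ(x') = ε + 2κ|x'|^m, h(x') = κ|x'|^m, G(x) = x3/δ(x'), ū⁽¹⁾(x) = c(1/2+G)e₁ + c(G²−1/4)(∂₁δ/2)e₃, p̄⁽¹⁾(x) = μ c x3∂₁δ/δ², and σ[ū⁽¹⁾,p̄⁽¹⁾] = 2μ e(ū⁽¹⁾) − p̄⁽¹⁾·Id₃ with e(v) = (∇v+(∇v)ᵀ)/2. Then there exists C > 0, independent of ε, such that for all ε ∈ (0,1): ‖ ∫_{|x'|<r} σ[ū⁽¹⁾,p̄⁽¹⁾](x', δ(x')/2)·(∂₁h(x'), ∂₂h(x'), −1) dx' + 2πμ c Γ₁₂⁽ᵐ⁾ ρ₁₂⁽ᵐ⁾(ε) e₁ ‖ ≤ C, where the norm is the Euclidean norm of ℝ³. -/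

import Mathlib

open Matrix MeasureTheory

/-- Gap width `δ(x') = ε + 2κ|x'|^m`. -/
noncomputable def δf (ε κ m x1 x2 : ℝ) : ℝ := ε + 2 * κ * Real.sqrt (x1 ^ 2 + x2 ^ 2) ^ m

/-- `∂₁δ(x') = 2κm|x'|^{m−2}x₁`. -/
noncomputable def d1δ (κ m x1 x2 : ℝ) : ℝ :=
  2 * κ * m * Real.sqrt (x1 ^ 2 + x2 ^ 2) ^ (m - 2) * x1

/-- The approximate shear velocity `ū⁽¹⁾ = c(1/2+G)e₁ + c(G²−1/4)(∂₁δ/2)e₃`. -/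
noncomputable def ubar1 (ε κ m c : ℝ) (x1 x2 x3 : ℝ) : Fin 3 → ℝ :=
  ![c * (1 / 2 + x3 / δf ε κ m x1 x2), 0,
    c * ((x3 / δf ε κ m x1 x2) ^ 2 - 1 / 4) * (d1δ κ m x1 x2 / 2)]

/-- The approximate shear pressure `p̄⁽¹⁾ = μcx₃∂₁δ/δ²`. -/
noncomputable def pbar1 (ε κ m μ c x1 x2 x3 : ℝ) : ℝ :=
  μ * c * x3 * d1δ κ m x1 x2 / (δf ε κ m x1 x2) ^ 2

/-- Jacobian matrix `(∇v)_{kl} = ∂ₗvₖ`. -/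
noncomputable def grad3 (v : ℝ → ℝ → ℝ → Fin 3 → ℝ) (x1 x2 x3 : ℝ) :
    Matrix (Fin 3) (Fin 3) ℝ :=
  Matrix.of fun k l =>
    ![deriv (fun t => v t x2 x3 k) x1, deriv (fun t => v x1 t x3 k) x2,
      deriv (fun t => v x1 x2 t k) x3] l

/-- Rate of strain tensor `e(v) = (∇v + (∇v)ᵀ)/2`. -/
noncomputable def symGrad (v : ℝ → ℝ → ℝ → Fin 3 → ℝ) (x1 x2 x3 : ℝ) :
    Matrix (Fin 3) (Fin 3) ℝ :=
  (1 / 2 : ℝ) • (grad3 v x1 x2 x3 + (grad3 v x1 x2 x3)ᵀ)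

/-- Cauchy stress `σ[ū⁽¹⁾,p̄⁽¹⁾] = 2μe(ū⁽¹⁾) − p̄⁽¹⁾·Id`. -/
noncomputable def sigma1 (ε κ m μ c x1 x2 x3 : ℝ) : Matrix (Fin 3) (Fin 3) ℝ :=
  (2 * μ) • symGrad (ubar1 ε κ m c) x1 x2 x3
    - pbar1 ε κ m μ c x1 x2 x3 • (1 : Matrix (Fin 3) (Fin 3) ℝ)

/-- `Γ₁₂⁽ᵐ⁾`. -/
noncomputable def Γ12 (κ m : ℝ) : ℝ :=
  if m = 2 then 1 / (4 * κ)
  else Real.Gamma (1 - 2 / m) * Real.Gamma (2 / m) / (m * (2 * κ) ^ (2 / m))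

/-- `ρ₁₂⁽ᵐ⁾(ε)`. -/
noncomputable def ρ12 (m ε : ℝ) : ℝ := if m = 2 then |Real.log ε| else ε ^ (2 / m - 1)

/-- Euclidean norm on `ℝ³`. -/
noncomputable def enorm3 (v : Fin 3 → ℝ) : ℝ :=
  Real.sqrt ((v 0) ^ 2 + (v 1) ^ 2 + (v 2) ^ 2)


lemma hasDerivAt_sqrt_sq_add_rpow (p x b : ℝ) (h : 0 < x ^ 2 + b) :
    HasDerivAt (fun t => Real.sqrt (t ^ 2 + b) ^ p)
      (p * Real.sqrt (x ^ 2 + b) ^ (p - 2) * x) x := by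
  have hs : 0 < Real.sqrt (x ^ 2 + b) := Real.sqrt_pos.2 h
  have h1 : HasDerivAt (fun t : ℝ => t ^ 2 + b) (2 * x) x := by
    simpa using ((hasDerivAt_id x).pow 2).add_const b
  have h2 := (h1.sqrt h.ne').rpow_const (p := p) (Or.inl hs.ne')
  convert h2 using 1
  have : p - 1 = (p - 2) + 1 := by ring
  rw [this, Real.rpow_add_one hs.ne']
  field_simp

lemma δf_comm (ε κ m x1 x2 : ℝ) : δf ε κ m x1 x2 = δf ε κ m x2 x1 := by
  simp only [δf, add_comm (x1 ^ 2)]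

lemma hasDerivAt_δf (ε κ m x1 x2 : ℝ) (h : 0 < x1 ^ 2 + x2 ^ 2) :
    HasDerivAt (fun t => δf ε κ m t x2) (d1δ κ m x1 x2) x1 := by
  have := ((hasDerivAt_sqrt_sq_add_rpow m x1 (x2 ^ 2) h).const_mul (2 * κ)).const_add ε
  convert! this using 1
  simp only [d1δ]; ring

lemma hasDerivAt_δf_right (ε κ m x1 x2 : ℝ) (h : 0 < x1 ^ 2 + x2 ^ 2) :
    HasDerivAt (fun t => δf ε κ m x1 t) (d1δ κ m x2 x1) x2 := by
  rw [funext fun t => δf_comm ε κ m x1 t]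
  exact hasDerivAt_δf ε κ m x2 x1 (by rwa [add_comm])

lemma differentiableAt_d1δ (κ m x1 x2 : ℝ) (h : 0 < x1 ^ 2 + x2 ^ 2) :
    DifferentiableAt ℝ (fun t => d1δ κ m t x2) x1 :=
  ((hasDerivAt_sqrt_sq_add_rpow (m - 2) x1 (x2 ^ 2) h).differentiableAt.const_mul
    (2 * κ * m)).mul differentiableAt_id

lemma differentiableAt_d1δ_right (κ m x1 x2 : ℝ) (h : 0 < x1 ^ 2 + x2 ^ 2) :
    DifferentiableAt ℝ (fun t => d1δ κ m x1 t) x2 := by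
  simp only [d1δ, add_comm (x1 ^ 2)]
  exact ((hasDerivAt_sqrt_sq_add_rpow (m - 2) x2 (x1 ^ 2)
    (by rwa [add_comm])).differentiableAt.const_mul (2 * κ * m)).mul (differentiableAt_const _)

lemma HasDerivAt.half_div {f : ℝ → ℝ} {f' y x : ℝ} (hf : HasDerivAt f f' x) (hx : f x ≠ 0)
    (hy : y = f x / 2) : HasDerivAt (fun t => y / f t) (-f' / (2 * f x)) x := by
  have := (hasDerivAt_const x y).div hf hx
  convert! this using 1
  subst hy
  field_simp
  ring

lemma deriv_vertical {c y x D : ℝ} {g k : ℝ → ℝ} (hg : HasDerivAt g D x) (hgx : g x = 1 / 2)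
    (hk : DifferentiableAt ℝ k x) (hy : k x = y) :
    deriv (fun t => c * (g t ^ 2 - 1 / 4) * (k t / 2)) x = c * D * (y / 2) := by
  have := (((hg.pow 2).sub_const (1 / 4)).const_mul c).mul (hk.hasDerivAt.div_const 2)
  rw [HasDerivAt.deriv (f' := c * D * (y / 2))]
  convert! this using 1
  simp [hgx, hy, show ((2 : ℝ) ^ 2)⁻¹ - 4⁻¹ = 0 by norm_num]

lemma grad3_ubar1 (ε κ m c x1 x2 : ℝ) (h : 0 < x1 ^ 2 + x2 ^ 2) (hδ : 0 < δf ε κ m x1 x2) :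
    grad3 (ubar1 ε κ m c) x1 x2 (δf ε κ m x1 x2 / 2) =
      !![c * (-d1δ κ m x1 x2 / (2 * δf ε κ m x1 x2)),
          c * (-d1δ κ m x2 x1 / (2 * δf ε κ m x1 x2)), c * (1 / δf ε κ m x1 x2);
        0, 0, 0;
        c * (-d1δ κ m x1 x2 / (2 * δf ε κ m x1 x2)) * (d1δ κ m x1 x2 / 2),
          c * (-d1δ κ m x2 x1 / (2 * δf ε κ m x1 x2)) * (d1δ κ m x1 x2 / 2),
          c * (1 / δf ε κ m x1 x2) * (d1δ κ m x1 x2 / 2)] := by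
  have h1 := (hasDerivAt_δf ε κ m x1 x2 h).half_div hδ.ne' rfl
  have h2 := (hasDerivAt_δf_right ε κ m x1 x2 h).half_div hδ.ne' rfl
  have h3 : HasDerivAt (fun t => t / δf ε κ m x1 x2) (1 / δf ε κ m x1 x2)
    (δf ε κ m x1 x2 / 2) := (hasDerivAt_id _).div_const _
  have hG : δf ε κ m x1 x2 / 2 / δf ε κ m x1 x2 = 1 / 2 := by field_simp
  have e1 := ((h1.const_add (1 / 2)).const_mul c).deriv
  have e2 := ((h2.const_add (1 / 2)).const_mul c).deriv
  have e3 := ((h3.const_add (1 / 2)).const_mul c).deriv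
  have e4 := deriv_vertical (c := c) h1 hG (differentiableAt_d1δ κ m x1 x2 h) rfl
  have e5 := deriv_vertical (c := c) h2 hG (differentiableAt_d1δ_right κ m x1 x2 h) rfl
  have e6 := deriv_vertical (c := c) h3 hG (differentiableAt_const (d1δ κ m x1 x2)) rfl
  ext k l
  fin_cases k <;> fin_cases l
  · exact e1
  · exact e2
  · exact e3
  · exact deriv_const _ _
  · exact deriv_const _ _
  · exact deriv_const _ _
  · exact e4
  · exact e5
  · exact e6

/-- The part of the traction density that stays bounded as the gap closes. -/
noncomputable def tractionRem (ε κ m μ c x1 x2 : ℝ) : Fin 3 → ℝ :=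
  ![-(μ * c) * (d1δ κ m x1 x2 * d1δ κ m x1 x2 / δf ε κ m x1 x2 / 2
      + d1δ κ m x2 x1 * d1δ κ m x2 x1 / δf ε κ m x1 x2 / 4),
    -(μ * c) * (d1δ κ m x1 x2 * d1δ κ m x2 x1 / δf ε κ m x1 x2 / 4),
    -(μ * c) * (d1δ κ m x1 x2 * (d1δ κ m x1 x2 * d1δ κ m x1 x2 / δf ε κ m x1 x2 / 8
      + d1δ κ m x2 x1 * d1δ κ m x2 x1 / δf ε κ m x1 x2 / 8))]

lemma traction_eq (ε κ m μ c x1 x2 : ℝ) (h : 0 < x1 ^ 2 + x2 ^ 2)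
    (hδ : 0 < δf ε κ m x1 x2) :
    (sigma1 ε κ m μ c x1 x2 (δf ε κ m x1 x2 / 2)).mulVec
      ![κ * m * Real.sqrt (x1 ^ 2 + x2 ^ 2) ^ (m - 2) * x1,
        κ * m * Real.sqrt (x1 ^ 2 + x2 ^ 2) ^ (m - 2) * x2, -1]
    = (-(μ * c) * (δf ε κ m x1 x2)⁻¹) • ![1, 0, 0] + tractionRem ε κ m μ c x1 x2 := by
  have n1 : κ * m * Real.sqrt (x1 ^ 2 + x2 ^ 2) ^ (m - 2) * x1 = d1δ κ m x1 x2 / 2 := by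
    simp only [d1δ]; ring
  have n2 : κ * m * Real.sqrt (x1 ^ 2 + x2 ^ 2) ^ (m - 2) * x2 = d1δ κ m x2 x1 / 2 := by
    simp only [d1δ, add_comm (x2 ^ 2)]; ring
  rw [n1, n2]
  simp only [sigma1, symGrad, grad3_ubar1 ε κ m c x1 x2 h hδ, pbar1, tractionRem]
  generalize d1δ κ m x1 x2 = a
  generalize d1δ κ m x2 x1 = b
  generalize δf ε κ m x1 x2 = d at hδ ⊢
  ext i
  fin_cases i <;>
  · simp [Matrix.mulVec, dotProduct, Fin.sum_univ_three, Matrix.one_apply]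
    field_simp
    ring

open Set in
lemma integral_div_add_rpow {a ε m : ℝ} (ha : 0 < a) (hε : 0 < ε) (hm : 2 < m) :
    IntegrableOn (fun s => s / (ε + a * s ^ m)) (Ioi 0) ∧
    ∫ s in Ioi (0 : ℝ), s / (ε + a * s ^ m) =
      Real.Gamma (1 - 2 / m) * Real.Gamma (2 / m) / (m * a ^ (2 / m)) * ε ^ (2 / m - 1) := by
  have hm0 : 0 < m := by linarith
  have h2m : 2 / m < 1 := by rw [div_lt_one hm0]; exact hm
  set f : ℝ → ℝ → ℝ := fun u s => s * Real.exp (-(u * (ε + a * s ^ m))) with hf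
  have hfeq : ∀ u s, f u s = Real.exp (-(ε * u)) * (s ^ (1 : ℝ) * Real.exp (-(a * u) * s ^ m)) := by
    intro u s
    rw [hf, Real.rpow_one, mul_left_comm, ← Real.exp_add]
    ring_nf
  have hslice : ∀ u ∈ Ioi (0 : ℝ), IntegrableOn (f u) (Ioi 0) := by
    intro u hu
    rw [funext (hfeq u)]
    exact (integrableOn_rpow_mul_exp_neg_mul_rpow (by norm_num) hm0 (mul_pos ha hu)).const_mul _
  have hval : ∀ u ∈ Ioi (0 : ℝ), ∫ s in Ioi (0 : ℝ), f u s =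
      a ^ (-(2 / m)) * (1 / m) * Real.Gamma (2 / m) *
        (u ^ ((1 - 2 / m) - 1) * Real.exp (-(ε * u))) := by
    intro u hu
    simp only [hfeq u]
    rw [integral_const_mul,
      integral_rpow_mul_exp_neg_mul_rpow hm0 (by norm_num) (mul_pos ha hu),
      show (-(1 + 1) / m : ℝ) = -(2 / m) by ring, show ((1 + 1) / m : ℝ) = 2 / m by ring,
      Real.mul_rpow ha.le (le_of_lt hu), show 1 - 2 / m - 1 = -(2 / m) by ring]
    ring
  have hcont : Continuous (Function.uncurry f) := by
    have : Continuous fun p : ℝ × ℝ => p.2 ^ m :=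
      continuous_snd.rpow_const fun _ => Or.inr hm0.le
    simp only [hf, Function.uncurry_def]
    fun_prop
  have hG := Real.integral_rpow_mul_exp_neg_mul_Ioi (a := 1 - 2 / m) (by linarith) hε
  have hGpos : 0 < (1 / ε) ^ (1 - 2 / m) * Real.Gamma (1 - 2 / m) :=
    mul_pos (by positivity) (Real.Gamma_pos_of_pos (by linarith))
  have hint : Integrable (Function.uncurry f)
      ((volume.restrict (Ioi 0)).prod (volume.restrict (Ioi 0))) := by
    rw [integrable_prod_iff hcont.aestronglyMeasurable]
    refine ⟨(ae_restrict_iff' measurableSet_Ioi).2 (.of_forall hslice), ?_⟩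
    have : IntegrableOn (fun u : ℝ => a ^ (-(2 / m)) * (1 / m) * Real.Gamma (2 / m) *
        (u ^ ((1 - 2 / m) - 1) * Real.exp (-(ε * u)))) (Ioi 0) :=
      Integrable.const_mul (.of_integral_ne_zero (by rw [hG]; exact hGpos.ne')) _
    refine this.congr_fun (fun u hu => ?_) measurableSet_Ioi
    refine (hval u hu).symm.trans ?_
    refine setIntegral_congr_fun measurableSet_Ioi fun s hs => ?_
    exact (Real.norm_of_nonneg (mul_nonneg (le_of_lt hs) (Real.exp_pos _).le)).symm
  have hinner : ∀ s ∈ Ioi (0 : ℝ), ∫ u in Ioi (0 : ℝ), f u s = s / (ε + a * s ^ m) := by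
    intro s hs
    have hpos : 0 < ε + a * s ^ m := by
      have := Real.rpow_pos_of_pos hs m
      positivity
    have := integral_exp_mul_Ioi (neg_neg_of_pos hpos) 0
    simp only [mul_zero, Real.exp_zero] at this
    simp only [hf, integral_const_mul]
    rw [show (fun u : ℝ => Real.exp (-(u * (ε + a * s ^ m)))) =
      fun u => Real.exp (-(ε + a * s ^ m) * u) by ext; ring_nf, this]
    field_simp
  refine ⟨hint.integral_prod_right.congr ((ae_restrict_iff' measurableSet_Ioi).2
    (.of_forall hinner)), ?_⟩
  rw [← setIntegral_congr_fun measurableSet_Ioi hinner, ← integral_integral_swap hint,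
    setIntegral_congr_fun measurableSet_Ioi hval, integral_const_mul, hG, one_div ε,
    Real.inv_rpow hε.le, ← Real.rpow_neg hε.le, Real.rpow_neg ha.le,
    show -(1 - 2 / m) = 2 / m - 1 by ring]
  field_simp

open Set in
lemma abs_integral_div_add_rpow_sub_le {κ ε m r : ℝ} (hκ : 0 < κ) (hε : 0 < ε) (hm : 2 < m)
    (hr : 0 < r) :
    |(∫ s in Ioo 0 r, s / (ε + 2 * κ * s ^ m)) - Γ12 κ m * ρ12 m ε| ≤
      (2 * κ)⁻¹ * (-r ^ (1 - m + 1) / (1 - m + 1)) := by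
  obtain ⟨hi, hv⟩ := integral_div_add_rpow (mul_pos two_pos hκ) hε hm
  have hsplit : ∫ s in Ioi (0 : ℝ), s / (ε + 2 * κ * s ^ m) =
      (∫ s in Ioo 0 r, s / (ε + 2 * κ * s ^ m)) + ∫ s in Ioi r, s / (ε + 2 * κ * s ^ m) := by
    rw [← integral_Ioc_eq_integral_Ioo, ← Ioc_union_Ioi_eq_Ioi hr.le]
    exact setIntegral_union (Ioc_disjoint_Ioi le_rfl) measurableSet_Ioi
      (hi.mono_set Ioc_subset_Ioi_self) (hi.mono_set (Ioi_subset_Ioi hr.le))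
  have hm' : 1 - m < -1 := by linarith
  have hnn : ∀ s ∈ Ioi r, 0 ≤ s / (ε + 2 * κ * s ^ m) := by
    intro s hs
    have : 0 < s := hr.trans hs
    positivity
  have htail : ∫ s in Ioi r, s / (ε + 2 * κ * s ^ m) ≤ ∫ s in Ioi r, (2 * κ)⁻¹ * s ^ (1 - m) := by
    refine setIntegral_mono_on (hi.mono_set (Ioi_subset_Ioi hr.le))
      ((integrableOn_Ioi_rpow_of_lt hm' hr).const_mul _) measurableSet_Ioi fun s hs => ?_
    have hs0 : 0 < s := hr.trans hs
    have hsm : 0 < s ^ m := Real.rpow_pos_of_pos hs0 m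
    rw [Real.rpow_sub hs0, Real.rpow_one, ← div_eq_inv_mul, div_div, mul_comm (s ^ m)]
    gcongr
    linarith
  rw [integral_const_mul, integral_Ioi_rpow_of_lt hm' hr] at htail
  have h0 := setIntegral_nonneg (μ := volume) measurableSet_Ioi hnn
  have hΓ : Γ12 κ m * ρ12 m ε = ∫ s in Ioi (0 : ℝ), s / (ε + 2 * κ * s ^ m) := by
    rw [hv, Γ12, ρ12, if_neg hm.ne', if_neg hm.ne']
  rw [hΓ, hsplit, abs_le]
  constructor <;> linarith

open Set in
lemma abs_integral_div_add_sq_sub_le {κ ε r : ℝ} (hκ : 0 < κ) (hε : ε ∈ Ioo (0 : ℝ) 1)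
    (hr : 0 < r) :
    |(∫ s in Ioo 0 r, s / (ε + 2 * κ * s ^ (2 : ℝ))) - Γ12 κ 2 * ρ12 2 ε| ≤
      (|Real.log (2 * κ * r ^ 2)| + |Real.log (1 + 2 * κ * r ^ 2)|) / (4 * κ) := by
  have hpos : ∀ s : ℝ, 0 < ε + 2 * κ * s ^ 2 := fun s => by have := hε.1; positivity
  have hd : ∀ s ∈ uIcc 0 r, HasDerivAt (fun s => Real.log (ε + 2 * κ * s ^ 2) / (4 * κ))
      (s / (ε + 2 * κ * s ^ 2)) s := by
    intro s _
    have h1 : HasDerivAt (fun s : ℝ => ε + 2 * κ * s ^ 2) (2 * κ * (2 * s)) s := by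
      simpa using ((hasDerivAt_pow 2 s).const_mul (2 * κ)).const_add ε
    convert! (h1.log (hpos s).ne').div_const (4 * κ) using 1
    have := (hpos s).ne'
    field_simp
    ring
  have hi := intervalIntegral.integral_eq_sub_of_hasDerivAt hd
    (ContinuousOn.intervalIntegrable (Continuous.continuousOn
      (continuous_id.div (by fun_prop) fun s => (hpos s).ne')))
  rw [intervalIntegral.integral_of_le hr.le, integral_Ioc_eq_integral_Ioo] at hi
  simp only [Real.rpow_two]
  rw [hi, Γ12, ρ12, if_pos rfl, if_pos rfl, abs_of_neg (Real.log_neg hε.1 hε.2)]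
  rw [show Real.log (ε + 2 * κ * r ^ 2) / (4 * κ) - Real.log (ε + 2 * κ * 0 ^ 2) / (4 * κ) -
    1 / (4 * κ) * -Real.log ε = Real.log (ε + 2 * κ * r ^ 2) / (4 * κ) by simp; ring,
    abs_div, abs_of_pos (by positivity : 0 < 4 * κ)]
  have h1 : Real.log (2 * κ * r ^ 2) ≤ Real.log (ε + 2 * κ * r ^ 2) :=
    Real.log_le_log (by positivity) (by linarith [hε.1])
  have h2 : Real.log (ε + 2 * κ * r ^ 2) ≤ Real.log (1 + 2 * κ * r ^ 2) :=
    Real.log_le_log (hpos r) (by linarith [hε.2])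
  gcongr
  rw [abs_le]
  constructor
  · linarith [neg_abs_le (Real.log (2 * κ * r ^ 2)), abs_nonneg (Real.log (1 + 2 * κ * r ^ 2))]
  · linarith [le_abs_self (Real.log (1 + 2 * κ * r ^ 2)), abs_nonneg (Real.log (2 * κ * r ^ 2))]

open Set in
lemma setIntegral_disc_radial (g : ℝ → ℝ) (r : ℝ) :
    ∫ p in {q : ℝ × ℝ | Real.sqrt (q.1 ^ 2 + q.2 ^ 2) < r}, g (Real.sqrt (p.1 ^ 2 + p.2 ^ 2)) =
      2 * Real.pi * ∫ s in Ioo 0 r, s * g s := by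
  have hS : MeasurableSet {q : ℝ × ℝ | Real.sqrt (q.1 ^ 2 + q.2 ^ 2) < r} :=
    (isOpen_lt (by fun_prop) continuous_const).measurableSet
  rw [← integral_indicator hS, ← integral_comp_polarCoord_symm, polarCoord_target]
  have hE : ∀ p ∈ Ioi (0 : ℝ) ×ˢ Ioo (-Real.pi) Real.pi,
      p.1 • indicator {q : ℝ × ℝ | Real.sqrt (q.1 ^ 2 + q.2 ^ 2) < r}
        (fun p => g (Real.sqrt (p.1 ^ 2 + p.2 ^ 2))) (polarCoord.symm p) =
      (Iio r).indicator (fun s => s * g s) p.1 * (fun _ => (1 : ℝ)) p.2 := by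
    rintro ⟨s, θ⟩ ⟨hs, -⟩
    have hs : 0 < s := hs
    have h : Real.sqrt ((s * Real.cos θ) ^ 2 + (s * Real.sin θ) ^ 2) = s := by
      rw [show (s * Real.cos θ) ^ 2 + (s * Real.sin θ) ^ 2 =
        s ^ 2 * (Real.sin θ ^ 2 + Real.cos θ ^ 2) by ring, Real.sin_sq_add_cos_sq, mul_one,
        Real.sqrt_sq hs.le]
    simp [indicator, polarCoord_symm_apply, h]
  rw [setIntegral_congr_fun (measurableSet_Ioi.prod measurableSet_Ioo) hE,
    Measure.volume_eq_prod, setIntegral_prod_mul ((Iio r).indicator fun s => s * g s) fun _ => (1 : ℝ),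
    setIntegral_indicator measurableSet_Iio,
    Ioi_inter_Iio]
  simp [Real.pi_pos.le]
  ring

lemma δf_pos {ε κ : ℝ} (hε : 0 < ε) (hκ : 0 < κ) (m x1 x2 : ℝ) : 0 < δf ε κ m x1 x2 := by
  unfold δf; positivity

lemma continuous_δf {ε κ m : ℝ} (hm : 2 ≤ m) : Continuous fun p : ℝ × ℝ => δf ε κ m p.1 p.2 := by
  have : Continuous fun p : ℝ × ℝ => Real.sqrt (p.1 ^ 2 + p.2 ^ 2) ^ m :=
    Continuous.rpow_const (by fun_prop) fun _ => Or.inr (by linarith)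
  unfold δf
  fun_prop

lemma continuous_d1δ {κ m : ℝ} (hm : 2 ≤ m) : Continuous fun p : ℝ × ℝ => d1δ κ m p.1 p.2 := by
  have : Continuous fun p : ℝ × ℝ => Real.sqrt (p.1 ^ 2 + p.2 ^ 2) ^ (m - 2) :=
    Continuous.rpow_const (by fun_prop) fun _ => Or.inr (by linarith)
  unfold d1δ
  fun_prop

lemma continuous_tractionRem {ε κ m μ c : ℝ} (hε : 0 < ε) (hκ : 0 < κ) (hm : 2 ≤ m) :
    Continuous fun p : ℝ × ℝ => tractionRem ε κ m μ c p.1 p.2 := by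
  have h0 := fun p : ℝ × ℝ => (δf_pos hε hκ m p.1 p.2).ne'
  have hδ := continuous_δf (ε := ε) (κ := κ) hm
  have h1 := continuous_d1δ (κ := κ) hm
  have h2 : Continuous fun p : ℝ × ℝ => d1δ κ m p.2 p.1 := h1.comp continuous_swap
  refine continuous_pi fun i => ?_
  fin_cases i <;>
  · simp [tractionRem]
    fun_prop (disch := exact h0)

lemma abs_le_sqrt_sq_add_sq (x y : ℝ) : |x| ≤ Real.sqrt (x ^ 2 + y ^ 2) :=
  Real.abs_le_sqrt (by nlinarith [sq_nonneg y])

lemma abs_d1δ_le {κ m x1 x2 r : ℝ} (hκ : 0 < κ) (hm : 2 ≤ m)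
    (h : Real.sqrt (x1 ^ 2 + x2 ^ 2) < r) :
    |d1δ κ m x1 x2| ≤ 2 * κ * m * r ^ (m - 2) * r := by
  have hx := abs_le_sqrt_sq_add_sq x1 x2
  have hs := Real.sqrt_nonneg (x1 ^ 2 + x2 ^ 2)
  have hm0 : 0 ≤ m := by linarith
  rw [d1δ, abs_mul, abs_of_nonneg (by positivity)]
  have : Real.sqrt (x1 ^ 2 + x2 ^ 2) ^ (m - 2) ≤ r ^ (m - 2) :=
    Real.rpow_le_rpow hs h.le (by linarith)
  have : 0 < r := hs.trans_lt h
  gcongr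
  linarith

lemma abs_slope_mul_slope_div_δf_le {ε κ m x1 x2 u v r : ℝ} (hε : 0 < ε) (hκ : 0 < κ)
    (hm : 2 ≤ m) (h : Real.sqrt (x1 ^ 2 + x2 ^ 2) < r) (hu : |u| ≤ Real.sqrt (x1 ^ 2 + x2 ^ 2))
    (hv : |v| ≤ Real.sqrt (x1 ^ 2 + x2 ^ 2)) :
    |2 * κ * m * Real.sqrt (x1 ^ 2 + x2 ^ 2) ^ (m - 2) * u *
      (2 * κ * m * Real.sqrt (x1 ^ 2 + x2 ^ 2) ^ (m - 2) * v) / δf ε κ m x1 x2| ≤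
      2 * κ * m ^ 2 * r ^ (m - 2) := by
  have hs := Real.sqrt_nonneg (x1 ^ 2 + x2 ^ 2)
  have hδ := δf_pos hε hκ m x1 x2
  have htr : Real.sqrt (x1 ^ 2 + x2 ^ 2) ^ (m - 2) ≤ r ^ (m - 2) :=
    Real.rpow_le_rpow hs h.le (by linarith)
  have hsm : Real.sqrt (x1 ^ 2 + x2 ^ 2) ^ m =
      Real.sqrt (x1 ^ 2 + x2 ^ 2) ^ (m - 2) * Real.sqrt (x1 ^ 2 + x2 ^ 2) ^ 2 := by
    rw [← Real.rpow_two (Real.sqrt _), ← Real.rpow_add_of_nonneg hs (by linarith) (by norm_num),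
      sub_add_cancel]
  rw [abs_div, abs_of_pos hδ, div_le_iff₀ hδ]
  unfold δf
  rw [hsm]
  have ht : 0 ≤ Real.sqrt (x1 ^ 2 + x2 ^ 2) ^ (m - 2) := by positivity
  generalize Real.sqrt (x1 ^ 2 + x2 ^ 2) ^ (m - 2) = t at *
  generalize Real.sqrt (x1 ^ 2 + x2 ^ 2) = s at *
  have huv : |u| * |v| ≤ s ^ 2 := by
    rw [pow_two]; gcongr
  calc |2 * κ * m * t * u * (2 * κ * m * t * v)|
      = 4 * κ ^ 2 * m ^ 2 * t ^ 2 * (|u| * |v|) := by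
        rw [show 2 * κ * m * t * u * (2 * κ * m * t * v) = 4 * κ ^ 2 * m ^ 2 * t ^ 2 * (u * v) by
          ring, abs_mul, abs_mul u, abs_of_nonneg (by positivity)]
    _ ≤ 4 * κ ^ 2 * m ^ 2 * t ^ 2 * s ^ 2 := by gcongr
    _ = 2 * κ * m ^ 2 * t * (2 * κ * (t * s ^ 2)) := by ring
    _ ≤ 2 * κ * m ^ 2 * r ^ (m - 2) * (ε + 2 * κ * (t * s ^ 2)) := by
        have := ht.trans htr
        gcongr
        linarith

lemma norm_tractionRem_le {ε κ m μ c x1 x2 r : ℝ} (hε : 0 < ε) (hκ : 0 < κ) (hm : 2 ≤ m)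
    (h : Real.sqrt (x1 ^ 2 + x2 ^ 2) < r) :
    ‖tractionRem ε κ m μ c x1 x2‖ ≤
      |μ * c| * ((1 + 2 * κ * m * r ^ (m - 2) * r) * (2 * κ * m ^ 2 * r ^ (m - 2))) := by
  have ha := abs_d1δ_le hκ hm h
  have hx1 := abs_le_sqrt_sq_add_sq x1 x2
  have hx2 : |x2| ≤ Real.sqrt (x1 ^ 2 + x2 ^ 2) := by
    rw [add_comm]; exact abs_le_sqrt_sq_add_sq x2 x1
  have h11 := abs_slope_mul_slope_div_δf_le hε hκ hm h hx1 hx1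
  have h12 := abs_slope_mul_slope_div_δf_le hε hκ hm h hx1 hx2
  have h22 := abs_slope_mul_slope_div_δf_le hε hκ hm h hx2 hx2
  have e1 : 2 * κ * m * Real.sqrt (x1 ^ 2 + x2 ^ 2) ^ (m - 2) * x1 = d1δ κ m x1 x2 := rfl
  have e2 : 2 * κ * m * Real.sqrt (x1 ^ 2 + x2 ^ 2) ^ (m - 2) * x2 = d1δ κ m x2 x1 := by
    rw [d1δ, add_comm (x2 ^ 2)]
  rw [e1] at h11
  rw [e1, e2] at h12
  rw [e2] at h22
  unfold tractionRem
  generalize 2 * κ * m ^ 2 * r ^ (m - 2) = K at *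
  generalize 2 * κ * m * r ^ (m - 2) * r = L at *
  generalize d1δ κ m x1 x2 * d1δ κ m x1 x2 / δf ε κ m x1 x2 = P at *
  generalize d1δ κ m x1 x2 * d1δ κ m x2 x1 / δf ε κ m x1 x2 = W at *
  generalize d1δ κ m x2 x1 * d1δ κ m x2 x1 / δf ε κ m x1 x2 = Q at *
  generalize d1δ κ m x1 x2 = a at *
  have hK : 0 ≤ K := (abs_nonneg _).trans h11
  have hL : 0 ≤ L := (abs_nonneg _).trans ha
  have hLK := mul_nonneg hL hK
  rw [abs_le] at h11 h12 h22
  rw [pi_norm_le_iff_of_nonneg (by positivity)]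
  intro i
  fin_cases i
  · simp only [Real.norm_eq_abs]
    change |-(μ * c) * (P / 2 + Q / 4)| ≤ _
    rw [abs_mul, abs_neg]
    gcongr
    rw [abs_le]
    constructor <;> nlinarith
  · simp only [Real.norm_eq_abs]
    change |-(μ * c) * (W / 4)| ≤ _
    rw [abs_mul, abs_neg]
    gcongr
    rw [abs_le]
    constructor <;> nlinarith
  · simp only [Real.norm_eq_abs]
    change |-(μ * c) * (a * (P / 8 + Q / 8))| ≤ _
    rw [abs_mul, abs_neg, abs_mul a]
    gcongr
    · linarith
    · rw [abs_le]
      constructor <;> linarith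

open Set in
lemma exists_abs_integral_inv_δf_sub_le {κ r m : ℝ} (hκ : 0 < κ) (hr : 0 < r) (hm : 2 ≤ m) :
    ∃ C, ∀ ε ∈ Ioo (0 : ℝ) 1,
      |(∫ p in {q : ℝ × ℝ | Real.sqrt (q.1 ^ 2 + q.2 ^ 2) < r}, (δf ε κ m p.1 p.2)⁻¹) -
        2 * Real.pi * (Γ12 κ m * ρ12 m ε)| ≤ C := by
  obtain ⟨C, hC⟩ : ∃ C, ∀ ε ∈ Ioo (0 : ℝ) 1,
      |(∫ s in Ioo 0 r, s / (ε + 2 * κ * s ^ m)) - Γ12 κ m * ρ12 m ε| ≤ C := by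
    rcases hm.eq_or_lt with rfl | hm
    · exact ⟨_, fun ε hε => abs_integral_div_add_sq_sub_le hκ hε hr⟩
    · exact ⟨_, fun ε hε => abs_integral_div_add_rpow_sub_le hκ hε.1 hm hr⟩
  refine ⟨2 * Real.pi * C, fun ε hε => ?_⟩
  have := setIntegral_disc_radial (fun s => (ε + 2 * κ * s ^ m)⁻¹) r
  simp only [← div_eq_mul_inv] at this
  simp only [δf]
  rw [this, ← mul_sub, abs_mul, abs_of_pos Real.two_pi_pos]
  have := hC ε hε
  gcongr

lemma enorm3_le_sum_abs (v : Fin 3 → ℝ) : enorm3 v ≤ |v 0| + |v 1| + |v 2| := by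
  rw [enorm3, Real.sqrt_le_left (by positivity), ← sq_abs (v 0), ← sq_abs (v 1), ← sq_abs (v 2)]
  nlinarith [mul_nonneg (abs_nonneg (v 0)) (abs_nonneg (v 1)),
    mul_nonneg (abs_nonneg (v 0)) (abs_nonneg (v 2)),
    mul_nonneg (abs_nonneg (v 1)) (abs_nonneg (v 2))]

/-- Approximate shear force from the gap:
`∫_{|x'|<r} σ[ū⁽¹⁾,p̄⁽¹⁾](x',δ/2)·(∂₁h,∂₂h,−1)dx' = −2πμcΓ₁₂⁽ᵐ⁾ρ₁₂⁽ᵐ⁾(ε)e₁ + O(1)`. -/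
theorem stmt15 (κ r m μ c : ℝ) (hκ : 0 < κ) (hr : 0 < r) (hm : 2 ≤ m) (hμ : 0 < μ) :
    ∃ C > 0, ∀ ε ∈ Set.Ioo (0 : ℝ) 1,
      enorm3
        ((∫ p in {q : ℝ × ℝ | Real.sqrt (q.1 ^ 2 + q.2 ^ 2) < r},
          (sigma1 ε κ m μ c p.1 p.2 (δf ε κ m p.1 p.2 / 2)).mulVec
            ![κ * m * Real.sqrt (p.1 ^ 2 + p.2 ^ 2) ^ (m - 2) * p.1,
              κ * m * Real.sqrt (p.1 ^ 2 + p.2 ^ 2) ^ (m - 2) * p.2, -1])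
        + (2 * Real.pi * μ * c * Γ12 κ m * ρ12 m ε) • ![1, 0, 0]) ≤ C := by
  set S : Set (ℝ × ℝ) := {q | Real.sqrt (q.1 ^ 2 + q.2 ^ 2) < r}
  have hS : MeasurableSet S := (isOpen_lt (by fun_prop) continuous_const).measurableSet
  have hbox : S ⊆ Set.Icc (-r, -r) (r, r) := by
    intro q hq
    have h1 := abs_le.1 ((abs_le_sqrt_sq_add_sq q.1 q.2).trans (le_of_lt hq))
    have h2 := abs_le.1 ((abs_le_sqrt_sq_add_sq q.2 q.1).trans
      (le_of_lt (by rw [add_comm]; exact hq)))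
    exact ⟨⟨h1.1, h2.1⟩, ⟨h1.2, h2.2⟩⟩
  have hfin : volume S < ⊤ := (measure_mono hbox).trans_lt isCompact_Icc.measure_lt_top
  obtain ⟨C, hC⟩ := exists_abs_integral_inv_δf_sub_le hκ hr hm
  set M := |μ * c| * ((1 + 2 * κ * m * r ^ (m - 2) * r) * (2 * κ * m ^ 2 * r ^ (m - 2)))
    * volume.real S
  refine ⟨max 1 (|μ * c| * C + 3 * M), by positivity, fun ε hε => le_max_of_le_right ?_⟩
  have hae : ∀ᵐ p : ℝ × ℝ, p ∈ S →
      (sigma1 ε κ m μ c p.1 p.2 (δf ε κ m p.1 p.2 / 2)).mulVec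
        ![κ * m * Real.sqrt (p.1 ^ 2 + p.2 ^ 2) ^ (m - 2) * p.1,
          κ * m * Real.sqrt (p.1 ^ 2 + p.2 ^ 2) ^ (m - 2) * p.2, -1] =
      (-(μ * c) * (δf ε κ m p.1 p.2)⁻¹) • ![1, 0, 0] + tractionRem ε κ m μ c p.1 p.2 := by
    filter_upwards [Measure.ae_ne volume (0 : ℝ × ℝ)] with p hp _
    refine traction_eq ε κ m μ c p.1 p.2 ?_ (δf_pos hε.1 hκ m p.1 p.2)
    by_contra h
    refine hp (Prod.ext ?_ ?_) <;> simp only [Prod.fst_zero, Prod.snd_zero] <;>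
      nlinarith [sq_nonneg p.1, sq_nonneg p.2]
  have hδi : IntegrableOn (fun p : ℝ × ℝ => -(μ * c) * (δf ε κ m p.1 p.2)⁻¹) S :=
    (continuous_const.mul ((continuous_δf hm).inv₀ fun p =>
      (δf_pos hε.1 hκ m p.1 p.2).ne')).integrableOn_Icc.mono_set hbox
  have hRi : IntegrableOn (fun p : ℝ × ℝ => tractionRem ε κ m μ c p.1 p.2) S :=
    (continuous_tractionRem hε.1 hκ hm).integrableOn_Icc.mono_set hbox
  rw [setIntegral_congr_ae hS hae, integral_add (hδi.smul_const _) hRi, integral_smul_const,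
    integral_const_mul]
  have hR : ‖∫ p in S, tractionRem ε κ m μ c p.1 p.2‖ ≤ M :=
    norm_setIntegral_le_of_norm_le_const hfin fun p hp => norm_tractionRem_le hε.1 hκ hm hp
  have hRc := fun i => (norm_le_pi_norm _ i).trans hR
  simp only [Real.norm_eq_abs] at hRc
  have hmain : |-(μ * c) * (∫ p in S, (δf ε κ m p.1 p.2)⁻¹) +
      2 * Real.pi * μ * c * Γ12 κ m * ρ12 m ε| ≤ |μ * c| * C := by
    rw [show -(μ * c) * (∫ p in S, (δf ε κ m p.1 p.2)⁻¹) +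
      2 * Real.pi * μ * c * Γ12 κ m * ρ12 m ε = -(μ * c) *
      ((∫ p in S, (δf ε κ m p.1 p.2)⁻¹) - 2 * Real.pi * (Γ12 κ m * ρ12 m ε)) by ring,
      abs_mul, abs_neg]
    exact mul_le_mul_of_nonneg_left (hC ε hε) (abs_nonneg _)
  generalize (∫ p in S, tractionRem ε κ m μ c p.1 p.2) = R at hRc ⊢
  generalize (∫ p in S, (δf ε κ m p.1 p.2)⁻¹) = I at hmain ⊢
  refine (enorm3_le_sum_abs _).trans ?_
  have h0 := hRc 0
  have h1 := hRc 1
  have h2 := hRc 2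
  generalize -(μ * c) * I = A at hmain ⊢
  generalize 2 * Real.pi * μ * c * Γ12 κ m * ρ12 m ε = B at hmain ⊢
  change |A * 1 + R 0 + B * 1| + |A * 0 + R 1 + B * 0| + |A * 0 + R 2 + B * 0| ≤ _
  rw [mul_one, mul_one, mul_zero, mul_zero, zero_add, zero_add, add_zero, add_zero,
    add_right_comm A]
  linarith [abs_add_le (A + B) (R 0)]
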